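/- arXiv:2011.07490 — 2 statements merged into one kernel-verified Lean document; each statement's English description precedes it below -/
import Mathlib

section
/- For every integer n ≥ 2, the map F_n is a bijection from ℝ^{d×d} onto ℝ^{d×d}. -/
/-- `F(T) = (1 + |T|^a)^{-1/a} T` on `ℝ^{d×d}`, realised as the Euclidean space
`EuclideanSpace ℝ (Fin d × Fin d)` (Frobenius norm). -/
noncomputable def matF (d : ℕ) (a : ℝ) (T : EuclideanSpace ℝ (Fin d × Fin d)) :
    EuclideanSpace ℝ (Fin d × Fin d) :=
  ((1 + ‖T‖ ^ a) ^ (-(1 / a))) • T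

/-- The regularised map `F_n(T) = F(T) + T / (n (1 + |T|^{1 - 1/n}))`. -/
noncomputable def matFn (d : ℕ) (a : ℝ) (n : ℕ) (T : EuclideanSpace ℝ (Fin d × Fin d)) :
    EuclideanSpace ℝ (Fin d × Fin d) :=
  matF d a T + ((n : ℝ) * (1 + ‖T‖ ^ (1 - 1 / (n : ℝ))))⁻¹ • T

open Set Filter

/-- A radial map `T ↦ c(‖T‖) T` is bijective as soon as `r ↦ c(r) r` is a strictly increasing
continuous unbounded function on `[0, ∞)` and `c > 0` there. -/
theorem bijective_radial_smul {E : Type*} [NormedAddCommGroup E] [NormedSpace ℝ E] {c : ℝ → ℝ}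
    (hpos : ∀ r, 0 ≤ r → 0 < c r) (hcont : ContinuousOn c (Ici 0))
    (hmono : StrictMonoOn (fun r => c r * r) (Ici 0))
    (hunbdd : ∀ M : ℝ, ∃ R, 0 ≤ R ∧ M ≤ c R * R) :
    Function.Bijective (fun T : E => c ‖T‖ • T) := by
  constructor
  · intro S T h
    have hnorm : ‖S‖ = ‖T‖ := by
      apply hmono.injOn (norm_nonneg S) (norm_nonneg T)
      have := congrArg norm h
      simpa [norm_smul, abs_of_pos (hpos _ (norm_nonneg _))] using this
    simp only [hnorm] at h
    exact smul_right_injective E (hpos _ (norm_nonneg T)).ne' h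
  · intro S
    obtain ⟨R, hR, hSR⟩ := hunbdd ‖S‖
    have hcont' : ContinuousOn (fun r => c r * r) (Icc 0 R) :=
      (hcont.mono Icc_subset_Ici_self).mul continuousOn_id
    obtain ⟨r, hr, hrS⟩ := intermediate_value_Icc hR hcont' ⟨by simp, hSR⟩
    have hc := hpos r hr.1
    have hnorm : ‖(c r)⁻¹ • S‖ = r := by
      rw [norm_smul, norm_inv, Real.norm_of_nonneg hc.le, ← hrS]
      field_simp
    exact ⟨(c r)⁻¹ • S, by simp only [hnorm, smul_inv_smul₀ hc.ne']⟩

theorem monotoneOn_one_add_rpow_neg_inv_mul {a : ℝ} (ha : 0 < a) :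
    MonotoneOn (fun r : ℝ => (1 + r ^ a) ^ (-(1 / a)) * r) (Ici 0) := by
  have key : ∀ r : ℝ, 0 ≤ r →
      (1 + r ^ a) ^ (-(1 / a)) * r = (r ^ a / (1 + r ^ a)) ^ (1 / a) := by
    intro r hr
    have hra := Real.rpow_nonneg hr a
    rw [Real.div_rpow hra (by positivity), ← Real.rpow_mul hr, mul_one_div_cancel ha.ne',
      Real.rpow_one, Real.rpow_neg (by positivity), inv_mul_eq_div]
  intro x hx y hy hxy
  have hx : 0 ≤ x := hx
  have hy : 0 ≤ y := hy
  simp only [key x hx, key y hy]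
  have hxa := Real.rpow_nonneg hx a
  have hxya := Real.rpow_le_rpow hx hxy ha.le
  apply Real.rpow_le_rpow (by positivity) _ (by positivity)
  rw [div_le_div_iff₀ (by positivity) (by positivity)]
  nlinarith

theorem strictMonoOn_inv_one_add_rpow_mul {b s : ℝ} (hb : 0 < b) (hs : 0 < s) (hs1 : s < 1) :
    StrictMonoOn (fun r : ℝ => (b * (1 + r ^ s))⁻¹ * r) (Ici 0) := by
  intro x hx y hy hxy
  have hx : 0 ≤ x := hx
  have hy : 0 ≤ y := hy
  have hxs := Real.rpow_nonneg hx s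
  have hys := Real.rpow_nonneg hy s
  have split : ∀ r : ℝ, 0 ≤ r → r = r ^ s * r ^ (1 - s) := fun r hr => by
    rw [← Real.rpow_add_of_nonneg hr hs.le (by linarith), add_sub_cancel, Real.rpow_one]
  have hle : x * y ^ s ≤ y * x ^ s := by
    have h := Real.rpow_le_rpow hx hxy.le (by linarith : 0 ≤ 1 - s)
    calc x * y ^ s = (x ^ s * y ^ s) * x ^ (1 - s) := by nth_rewrite 1 [split x hx]; ring
      _ ≤ (x ^ s * y ^ s) * y ^ (1 - s) := by gcongr
      _ = y * x ^ s := by nth_rewrite 3 [split y hy]; ring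
  simp only [← div_eq_inv_mul]
  rw [div_lt_div_iff₀ (by positivity) (by positivity)]
  nlinarith

theorem exists_le_inv_one_add_rpow_mul {b s : ℝ} (hb : 0 < b) (hs : 0 < s) (hs1 : s < 1) (M : ℝ) :
    ∃ R, 0 ≤ R ∧ M ≤ (b * (1 + R ^ s))⁻¹ * R := by
  obtain ⟨R, hR, hR1⟩ := (((tendsto_rpow_atTop (by linarith : 0 < 1 - s)).eventually_ge_atTop
    (2 * b * |M|)).and (eventually_ge_atTop 1)).exists
  have hR0 : 0 ≤ R := by linarith
  refine ⟨R, hR0, (le_abs_self M).trans ?_⟩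
  have hRs := Real.one_le_rpow hR1 hs.le
  have hsplit : R = R ^ s * R ^ (1 - s) := by
    rw [← Real.rpow_add_of_nonneg hR0 hs.le (by linarith), add_sub_cancel, Real.rpow_one]
  rw [← div_eq_inv_mul, le_div_iff₀ (by positivity)]
  calc |M| * (b * (1 + R ^ s)) ≤ |M| * (b * (R ^ s + R ^ s)) := by gcongr
    _ = R ^ s * (2 * b * |M|) := by ring
    _ ≤ R ^ s * R ^ (1 - s) := by gcongr
    _ = R := hsplit.symm

/-- For every integer `n ≥ 2`, the map `F_n` is a bijection from
`ℝ^{d×d}` onto `ℝ^{d×d}`. -/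
theorem stmt_5 {d : ℕ} (hd : 1 ≤ d) {a : ℝ} (ha : 0 < a) (n : ℕ) (hn : 2 ≤ n) :
    Function.Bijective (matFn d a n) := by
  have hn2 : (2 : ℝ) ≤ n := by exact_mod_cast hn
  have hn0 : (0 : ℝ) < n := by linarith
  have hs1 : 1 - 1 / (n : ℝ) < 1 := by linarith [one_div_pos.2 hn0]
  have hs : 0 < 1 - 1 / (n : ℝ) := by
    rw [sub_pos, div_lt_one hn0]
    linarith
  have hF : matFn d a n = fun T => ((1 + ‖T‖ ^ a) ^ (-(1 / a)) +
      ((n : ℝ) * (1 + ‖T‖ ^ (1 - 1 / (n : ℝ))))⁻¹) • T := by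
    funext T
    simp only [matFn, matF, add_smul]
  rw [hF]
  generalize 1 - 1 / (n : ℝ) = s at hs hs1
  apply bijective_radial_smul (c := fun r => (1 + r ^ a) ^ (-(1 / a)) + ((n : ℝ) * (1 + r ^ s))⁻¹)
  · intro r hr
    positivity
  · have hne : ∀ p r : ℝ, r ∈ Ici (0 : ℝ) → 1 + r ^ p ≠ 0 := fun p r hr =>
      (add_pos_of_pos_of_nonneg one_pos (Real.rpow_nonneg hr p)).ne'
    have hc : ∀ p : ℝ, 0 < p → ContinuousOn (fun r : ℝ => 1 + r ^ p) (Ici 0) := fun p hp =>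
      continuousOn_const.add (Real.continuous_rpow_const hp.le).continuousOn
    exact ((hc a ha).rpow_const fun r hr => Or.inl (hne a r hr)).add
      ((continuousOn_const.mul (hc s hs)).inv₀ fun r hr => mul_ne_zero hn0.ne' (hne s r hr))
  · simp only [add_mul]
    exact (monotoneOn_one_add_rpow_neg_inv_mul ha).add_strictMono
      (strictMonoOn_inv_one_add_rpow_mul hn0 hs hs1)
  · intro M
    obtain ⟨R, hR, hM⟩ := exists_le_inv_one_add_rpow_mul hn0 hs hs1 M
    refine ⟨R, hR, hM.trans ?_⟩
    rw [add_mul]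
    exact le_add_of_nonneg_left (by positivity)
end

section
/- There exists a constant C_a > 0 depending only on a such that for every integer n ≥ 2 and every T ∈ ℝ^{d×d} with T ≠ 0, the derivative DF_n(T) (a linear map on ℝ^{d×d}) is invertible and the operator norm of its inverse satisfies ‖(DF_n(T))^{−1}‖ ≤ C_a (1 + |T|^{a+1}). -/
theorem hasFDerivAt_norm_of_ne_zero {E : Type*} [NormedAddCommGroup E] [InnerProductSpace ℝ E]
    {x : E} (hx : x ≠ 0) :
    HasFDerivAt (fun y : E => ‖y‖) (‖x‖⁻¹ • innerSL ℝ x) x := by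
  have h := (hasStrictFDerivAt_norm_sq x).hasFDerivAt.sqrt
    (pow_ne_zero 2 (norm_ne_zero_iff.2 hx))
  simp only [Real.sqrt_sq (norm_nonneg _)] at h
  convert h using 1
  ext y
  have := norm_ne_zero_iff.2 hx
  simp
  field_simp

/-- A radial vector field with nonincreasing profile `g` has a derivative bounded below, as a
quadratic form, by its radial eigenvalue `g r + r g' r`. -/
theorem exists_hasFDerivAt_radial_smul {E : Type*} [NormedAddCommGroup E]
    [InnerProductSpace ℝ E] {g : ℝ → ℝ} {g' : ℝ} {x : E} (hx : x ≠ 0)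
    (hg : HasDerivAt g g' ‖x‖) (hg' : g' ≤ 0) :
    ∃ L : E →L[ℝ] E, HasFDerivAt (fun y => g ‖y‖ • y) L x ∧
      ∀ v, (g ‖x‖ + ‖x‖ * g') * ‖v‖ ^ 2 ≤ inner ℝ (L v) v := by
  have hr : 0 < ‖x‖ := norm_pos_iff.2 hx
  refine ⟨_, (hg.comp_hasFDerivAt x (hasFDerivAt_norm_of_ne_zero hx)).smul
    (hasFDerivAt_id x), fun v => ?_⟩
  have hcs : inner ℝ x v ^ 2 ≤ ‖x‖ ^ 2 * ‖v‖ ^ 2 := by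
    rw [← mul_pow, sq_le_sq, abs_of_nonneg (by positivity : 0 ≤ ‖x‖ * ‖v‖)]
    exact abs_real_inner_le_norm x v
  have key : (-g' * ‖x‖⁻¹) * inner ℝ x v ^ 2 ≤ (-g' * ‖x‖⁻¹) * (‖x‖ ^ 2 * ‖v‖ ^ 2) :=
    mul_le_mul_of_nonneg_left hcs (mul_nonneg (neg_nonneg.2 hg') (by positivity))
  have e : (-g' * ‖x‖⁻¹) * (‖x‖ ^ 2 * ‖v‖ ^ 2) = -(‖x‖ * g' * ‖v‖ ^ 2) := by
    field_simp
  simp [inner_add_left, inner_smul_left]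
  nlinarith

/-- In finite dimension, a coercive operator is invertible, with the reciprocal of the coercivity
constant bounding the norm of the inverse. -/
theorem exists_continuousLinearEquiv_of_coercive {E : Type*} [NormedAddCommGroup E]
    [InnerProductSpace ℝ E] [FiniteDimensional ℝ E] (L : E →L[ℝ] E) {m : ℝ} (hm : 0 < m)
    (h : ∀ v, m * ‖v‖ ^ 2 ≤ inner ℝ (L v) v) :
    ∃ φ : E ≃L[ℝ] E, (φ : E →L[ℝ] E) = L ∧ ‖(φ.symm : E →L[ℝ] E)‖ ≤ m⁻¹ := by
  have hb : ∀ v, m * ‖v‖ ≤ ‖L v‖ := fun v => by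
    rcases eq_or_ne v 0 with rfl | hv
    · simp
    · have h1 := (h v).trans (real_inner_le_norm _ _)
      have h2 : 0 < ‖v‖ := norm_pos_iff.2 hv
      exact le_of_mul_le_mul_right (by linarith) h2
  have hinj : Function.Injective (L : E →ₗ[ℝ] E) := by
    refine (injective_iff_map_eq_zero _).2 fun v hv => ?_
    have h1 := hb v
    rw [show L v = 0 from hv, norm_zero] at h1
    exact norm_le_zero_iff.1 (nonpos_of_mul_nonpos_right h1 hm)
  let φ : E ≃L[ℝ] E := (LinearEquiv.ofInjectiveEndo (L : E →ₗ[ℝ] E) hinj).toContinuousLinearEquiv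
  have hφ : ∀ v, φ v = L v := fun v => rfl
  refine ⟨φ, ContinuousLinearMap.ext hφ,
    ContinuousLinearMap.opNorm_le_bound _ (by positivity) fun w => ?_⟩
  have h1 := hb (φ.symm w)
  rw [← hφ, φ.apply_symm_apply] at h1
  rw [inv_mul_eq_div, le_div_iff₀' hm]
  exact h1

theorem one_add_rpow_rpow_le {a r : ℝ} (ha : 0 < a) (hr : 0 < r) :
    (1 + r ^ a) ^ (1 / a + 1) ≤ 2 ^ (1 / a + 1) * (1 + r ^ (a + 1)) := by
  have he : 0 ≤ 1 / a + 1 := by positivity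
  have h2 : (0 : ℝ) < 2 ^ (1 / a + 1) := by positivity
  have hra : 0 < r ^ a := by positivity
  have hrb : 0 < r ^ (a + 1) := by positivity
  rcases le_total r 1 with h | h
  · have h1 : r ^ a ≤ 1 := Real.rpow_le_one hr.le h ha.le
    calc (1 + r ^ a) ^ (1 / a + 1) ≤ 2 ^ (1 / a + 1) :=
          Real.rpow_le_rpow (by positivity) (by linarith) he
      _ ≤ _ := le_mul_of_one_le_right h2.le (by linarith)
  · have h1 : 1 ≤ r ^ a := Real.one_le_rpow h ha.le
    calc (1 + r ^ a) ^ (1 / a + 1) ≤ (2 * r ^ a) ^ (1 / a + 1) :=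
          Real.rpow_le_rpow (by positivity) (by linarith) he
      _ = 2 ^ (1 / a + 1) * r ^ (a + 1) := by
          rw [Real.mul_rpow (by positivity) hra.le, ← Real.rpow_mul hr.le]
          congr 2
          field_simp
          ring
      _ ≤ _ := mul_le_mul_of_nonneg_left (by linarith) h2.le

theorem hasDerivAt_one_add_rpow_rpow {a r : ℝ} (ha : 0 < a) (hr : 0 < r) :
    HasDerivAt (fun t : ℝ => (1 + t ^ a) ^ (-(1 / a)))
      (-(r ^ (a - 1) * (1 + r ^ a) ^ (-(1 / a + 1)))) r := by
  have h := ((Real.hasDerivAt_rpow_const (p := a) (Or.inl hr.ne')).const_add 1).rpow_const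
    (p := -(1 / a)) (Or.inl (by positivity))
  convert h using 1
  rw [show -(1 / a) - 1 = -(1 / a + 1) by ring]
  field_simp

theorem hasDerivAt_inv_mul_one_add_rpow {b c r : ℝ} (hc : 0 < c) (hr : 0 < r) :
    HasDerivAt (fun t : ℝ => (c * (1 + t ^ b))⁻¹)
      (-(c * (b * r ^ (b - 1)) / (c * (1 + r ^ b)) ^ 2)) r := by
  have h := (((Real.hasDerivAt_rpow_const (p := b)
    (Or.inl hr.ne')).const_add 1).const_mul c).inv (by positivity)
  rw [← neg_div]
  exact h

/-- There is a constant `C_a > 0`, depending only on `a`, such that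
for every integer `n ≥ 2` and every `T ≠ 0`, the Fréchet derivative `DF_n(T)` is an
invertible linear map on `ℝ^{d×d}` whose inverse has operator norm at most
`C_a (1 + |T|^{a+1})`. -/
theorem stmt_8 {d : ℕ} (hd : 1 ≤ d) {a : ℝ} (ha : 0 < a) :
    ∃ C : ℝ, 0 < C ∧ ∀ n : ℕ, 2 ≤ n → ∀ T : EuclideanSpace ℝ (Fin d × Fin d), T ≠ 0 →
      ∃ φ : EuclideanSpace ℝ (Fin d × Fin d) ≃L[ℝ] EuclideanSpace ℝ (Fin d × Fin d),
        (φ : EuclideanSpace ℝ (Fin d × Fin d) →L[ℝ] EuclideanSpace ℝ (Fin d × Fin d))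
            = fderiv ℝ (matFn d a n) T ∧
        ‖(φ.symm : EuclideanSpace ℝ (Fin d × Fin d) →L[ℝ]
            EuclideanSpace ℝ (Fin d × Fin d))‖ ≤ C * (1 + ‖T‖ ^ (a + 1)) := by
  refine ⟨2 ^ (1 / a + 1), by positivity, fun n hn T hT => ?_⟩
  have hr : 0 < ‖T‖ := norm_pos_iff.2 hT
  have hn2 : (2 : ℝ) ≤ n := by exact_mod_cast hn
  have hn0 : (0 : ℝ) < n := by linarith
  set r := ‖T‖ with hrdef
  set b : ℝ := 1 - 1 / (n : ℝ) with hb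
  have hb0 : 0 ≤ b := by
    rw [hb, sub_nonneg, div_le_one hn0]
    linarith
  have hb1 : b ≤ 1 := by
    rw [hb]
    linarith [one_div_pos.2 hn0]
  have hra : 0 < r ^ a := by positivity
  have hrb : 0 < r ^ b := by positivity
  have hd1 := hasDerivAt_one_add_rpow_rpow ha hr
  have hd2 := hasDerivAt_inv_mul_one_add_rpow (b := b) hn0 hr
  obtain ⟨L, hL, hLc⟩ := exists_hasFDerivAt_radial_smul hT (hd1.add hd2) (by
    have h1 : 0 ≤ r ^ (a - 1) * (1 + r ^ a) ^ (-(1 / a + 1)) := by positivity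
    have h2 : 0 ≤ n * (b * r ^ (b - 1)) / (n * (1 + r ^ b)) ^ 2 := by positivity
    linarith)
  have hm : 0 < (1 + r ^ a) ^ (-(1 / a + 1)) := by positivity
  have hF : (1 + r ^ a) ^ (-(1 / a)) + r * -(r ^ (a - 1) * (1 + r ^ a) ^ (-(1 / a + 1)))
      = (1 + r ^ a) ^ (-(1 / a + 1)) := by
    have h1 : r * r ^ (a - 1) = r ^ a := by
      rw [Real.rpow_sub_one hr.ne']
      field_simp
    have h2 : (1 + r ^ a) ^ (-(1 / a)) = (1 + r ^ a) ^ (-(1 / a + 1)) * (1 + r ^ a) := by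
      rw [← Real.rpow_add_one (by positivity)]
      congr 1
      ring
    rw [h2]
    linear_combination -(1 + r ^ a) ^ (-(1 / a + 1)) * h1
  have hH : 0 ≤ (n * (1 + r ^ b))⁻¹ + r * -(n * (b * r ^ (b - 1)) / (n * (1 + r ^ b)) ^ 2) := by
    have h1 : r * r ^ (b - 1) = r ^ b := by
      rw [Real.rpow_sub_one hr.ne']
      field_simp
    have h2 : (n * (1 + r ^ b))⁻¹ + r * -(n * (b * r ^ (b - 1)) / (n * (1 + r ^ b)) ^ 2)
        = n * (1 + (1 - b) * r ^ b) / (n * (1 + r ^ b)) ^ 2 := by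
      rw [← h1]
      have h3 : 1 + r * r ^ (b - 1) ≠ 0 := by positivity
      field_simp
      ring
    rw [h2]
    have := sub_nonneg.2 hb1
    positivity
  have hcoer : ∀ v, (1 + r ^ a) ^ (-(1 / a + 1)) * ‖v‖ ^ 2 ≤ inner ℝ (L v) v := fun v => by
    refine (mul_le_mul_of_nonneg_right ?_ (by positivity)).trans (hLc v)
    simp only [Pi.add_apply, ← hrdef]
    linarith
  obtain ⟨φ, hφ, hφn⟩ := exists_continuousLinearEquiv_of_coercive L hm hcoer
  refine ⟨φ, ?_, ?_⟩
  · rw [hφ, ← hL.fderiv]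
    congr 1
    funext S
    simp only [matFn, matF, Pi.add_apply, add_smul, hb]
  · refine hφn.trans ?_
    rw [← Real.rpow_neg (by positivity), neg_neg]
    exact one_add_rpow_rpow_le ha hr
end
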